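/- arXiv:2010.11733 — 2 statements merged into one kernel-verified Lean document; each statement's English description precedes it below -/
import Mathlib

section
/- Surjectivity of the policy transposition map (single-agent, fixed observation form): for every strictly positive probability distribution π on the subsets of {1,…,m}, there exists a sequential policy q — a function assigning to each ε ⊆ {1,…,m} a probability distribution over the choices ({1,…,m} \ ε) ∪ {†} (all values nonnegative, q(j | ε) = 0 for j ∈ ε, and q(† | ε) + Σ_{j ∉ ε} q(j | ε) = 1) — such that π = φ(q), i.e., for every ε ⊆ {1,…,m} of cardinality p, Σ over all orderings (j_1,…,j_p) of ε of the product q(j_1 | ∅) · q(j_2 | {j_1}) · ⋯ · q(j_p | {j_1,…,j_{p−1}}) · q(† | ε) equals π(ε). -/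
/-- Given a policy `q` (where `q ε (some j)` is the probability of choosing `j` next
and `q ε none` that of the termination symbol `†`), `seqProd q ε (j₁ :: ⋯ :: jₚ :: [])`
is the product
`q(j₁ | ε) · q(j₂ | ε ∪ {j₁}) · ⋯ · q(jₚ | ε ∪ {j₁,…,j_{p−1}}) · q(† | ε ∪ {j₁,…,jₚ})`. -/
def seqProd {m : ℕ} (q : Finset (Fin m) → Option (Fin m) → ℝ) :
    Finset (Fin m) → List (Fin m) → ℝ
  | ε, [] => q ε none
  | ε, j :: L => q ε (some j) * seqProd q (insert j ε) L

/-- `IsInit ε B` says that `ε` is an initial segment of `B`. -/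
def IsInit {m : ℕ} (ε B : Finset (Fin m)) : Prop :=
  ε ⊆ B ∧ ∀ b ∈ B, b ∉ ε → ∀ a ∈ ε, a < b

open Classical in
/-- The total weight of the sets having `ε` as an initial segment. -/
noncomputable def initWeight {m : ℕ} (π : Finset (Fin m) → ℝ) (ε : Finset (Fin m)) : ℝ :=
  ∑ B with IsInit ε B, π B

/-- The policy that draws a set according to `π` and reveals it in increasing order. -/
noncomputable def increasingPolicy {m : ℕ} (π : Finset (Fin m) → ℝ) (ε : Finset (Fin m)) :
    Option (Fin m) → ℝ
  | none => π ε / initWeight π ε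
  | some j => if ∀ a ∈ ε, a < j then initWeight π (insert j ε) / initWeight π ε else 0

lemma initWeight_pos {m : ℕ} {π : Finset (Fin m) → ℝ} (hpos : ∀ A, 0 < π A)
    (ε : Finset (Fin m)) : 0 < initWeight π ε := by
  classical
  exact Finset.sum_pos (fun B _ => hpos B) ⟨ε, Finset.mem_filter.2
    ⟨Finset.mem_univ _, subset_rfl, fun _ hb hb' => absurd hb hb'⟩⟩

lemma initWeight_empty {m : ℕ} (π : Finset (Fin m) → ℝ) :
    initWeight π ∅ = ∑ A, π A := by
  simp [initWeight, IsInit]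

lemma isInit_iff {m : ℕ} (ε B : Finset (Fin m)) :
    IsInit ε B ↔ B = ε ∨ ∃ j, (∀ a ∈ ε, a < j) ∧ IsInit (insert j ε) B := by
  constructor
  · rintro ⟨hsub, hlt⟩
    by_cases hne : (B \ ε).Nonempty
    · right
      obtain ⟨hB, hε⟩ := Finset.mem_sdiff.1 ((B \ ε).min'_mem hne)
      refine ⟨(B \ ε).min' hne, hlt _ hB hε, Finset.insert_subset hB hsub, ?_⟩
      intro b hb hb' a ha
      rw [Finset.mem_insert, not_or] at hb'
      rcases Finset.mem_insert.1 ha with rfl | ha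
      · exact lt_of_le_of_ne (Finset.min'_le _ _ (Finset.mem_sdiff.2 ⟨hb, hb'.2⟩)) (Ne.symm hb'.1)
      · exact hlt b hb hb'.2 a ha
    · left
      rw [Finset.not_nonempty_iff_eq_empty, Finset.sdiff_eq_empty_iff_subset] at hne
      exact hne.antisymm hsub
  · rintro (rfl | ⟨j, hj, hsub, hlt⟩)
    · exact ⟨subset_rfl, fun b hb hb' => absurd hb hb'⟩
    · refine ⟨(Finset.subset_insert _ _).trans hsub, fun b hb hbε a ha => ?_⟩
      by_cases hbj : b = j
      · exact hbj ▸ hj a ha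
      · exact hlt b hb (by simp [hbj, hbε]) a (Finset.mem_insert_of_mem ha)

lemma IsInit.eq_of_insert {m : ℕ} {ε B : Finset (Fin m)} {j k : Fin m}
    (hj : ∀ a ∈ ε, a < j) (hk : ∀ a ∈ ε, a < k)
    (hjB : IsInit (insert j ε) B) (hkB : IsInit (insert k ε) B) : j = k := by
  by_contra hne
  have hjε : j ∉ ε := fun h => (hj j h).false
  have hkε : k ∉ ε := fun h => (hk k h).false
  have h₁ := hjB.2 k (hkB.1 (Finset.mem_insert_self _ _)) (by simp [Ne.symm hne, hkε]) j
    (Finset.mem_insert_self _ _)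
  have h₂ := hkB.2 j (hjB.1 (Finset.mem_insert_self _ _)) (by simp [hne, hjε]) k
    (Finset.mem_insert_self _ _)
  exact lt_asymm h₁ h₂

lemma initWeight_eq {m : ℕ} (π : Finset (Fin m) → ℝ) (ε : Finset (Fin m)) :
    initWeight π ε = π ε + ∑ j with ∀ a ∈ ε, a < j, initWeight π (insert j ε) := by
  classical
  unfold initWeight
  rw [← Finset.sum_biUnion, ← Finset.sum_insert]
  · congr 1
    ext B
    simp [isInit_iff ε B]
  · simp only [Finset.mem_biUnion, Finset.mem_filter, Finset.mem_univ, true_and, not_exists,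
      not_and]
    exact fun j hj h => (hj j (h.1 (Finset.mem_insert_self _ _))).false
  · intro j hj k hk hne
    refine Finset.disjoint_left.2 fun B hjB hkB => hne ?_
    simp only [Finset.coe_filter, Finset.mem_filter, Finset.mem_univ, true_and,
      Set.mem_ofPred_eq] at hj hk hjB hkB
    exact hjB.eq_of_insert hj hk hkB

lemma initWeight_mul_seqProd {m : ℕ} {π : Finset (Fin m) → ℝ} (hpos : ∀ A, 0 < π A)
    (L : List (Fin m)) (ε : Finset (Fin m)) (hL : L.Pairwise (· < ·))
    (hε : ∀ b ∈ L, ∀ a ∈ ε, a < b) :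
    initWeight π ε * seqProd (increasingPolicy π) ε L = π (ε ∪ L.toFinset) := by
  induction L generalizing ε with
  | nil =>
    have := (initWeight_pos hpos ε).ne'
    simp only [seqProd, increasingPolicy, List.toFinset_nil, Finset.union_empty]
    field_simp
  | cons j L ih =>
    rw [List.pairwise_cons] at hL
    have hj : ∀ a ∈ ε, a < j := hε j List.mem_cons_self
    have hrec := ih (insert j ε) hL.2 fun b hb a ha => by
      rcases Finset.mem_insert.1 ha with rfl | ha
      · exact hL.1 b hb
      · exact hε b (List.mem_cons_of_mem _ hb) a ha
    have := (initWeight_pos hpos ε).ne'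
    rw [List.toFinset_cons, Finset.union_insert, ← Finset.insert_union, ← hrec]
    simp only [seqProd, increasingPolicy, if_pos hj]
    field_simp

lemma pairwise_lt_of_seqProd_ne_zero {m : ℕ} {π : Finset (Fin m) → ℝ} (L : List (Fin m))
    (ε : Finset (Fin m)) (h : seqProd (increasingPolicy π) ε L ≠ 0) :
    L.Pairwise (· < ·) ∧ ∀ b ∈ L, ∀ a ∈ ε, a < b := by
  induction L generalizing ε with
  | nil => simp
  | cons j L ih =>
    obtain ⟨hj, hL⟩ := mul_ne_zero_iff.1 h
    obtain ⟨hpw, hlt⟩ := ih _ hL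
    have hj' : ∀ a ∈ ε, a < j := by
      by_contra hn
      exact hj (if_neg hn)
    refine ⟨List.pairwise_cons.2 ⟨fun b hb => hlt b hb j (Finset.mem_insert_self _ _), hpw⟩, ?_⟩
    intro b hb a ha
    rcases List.mem_cons.1 hb with rfl | hb
    · exact hj' a ha
    · exact hlt b hb a (Finset.mem_insert_of_mem ha)

/-- Surjectivity of the policy transposition map `φ` (single-agent form): for every
strictly positive probability distribution `π` on the subsets of `Fin m` there is a
sequential policy `q` — nonnegative, supported outside the already-chosen set, and
normalized (`q(† | ε) + Σ_{j ∉ ε} q(j | ε) = 1`) — such that `φ(q) = π`, i.e. for every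
`ε` the sum over all orderings `(j₁, …, jₚ)` of `ε` of
`q(j₁ | ∅) · q(j₂ | {j₁}) · ⋯ · q(jₚ | {j₁,…,j_{p−1}}) · q(† | ε)` equals `π(ε)`. -/
theorem policy_transposition_surjective (m : ℕ) (hm : 1 ≤ m)
    (π : Finset (Fin m) → ℝ)
    (hpos : ∀ A : Finset (Fin m), 0 < π A)
    (hsum : ∑ A : Finset (Fin m), π A = 1) :
    ∃ q : Finset (Fin m) → Option (Fin m) → ℝ,
      (∀ ε : Finset (Fin m), ∀ x : Option (Fin m), 0 ≤ q ε x) ∧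
      (∀ ε : Finset (Fin m), ∀ j ∈ ε, q ε (some j) = 0) ∧
      (∀ ε : Finset (Fin m), q ε none + ∑ j ∈ εᶜ, q ε (some j) = 1) ∧
      (∀ ε : Finset (Fin m),
        ((ε.toList.permutations).map (fun L => seqProd q ∅ L)).sum = π ε) := by
  refine ⟨increasingPolicy π, ?_, ?_, ?_, ?_⟩
  · rintro ε (_ | j)
    · exact div_nonneg (hpos ε).le (initWeight_pos hpos ε).le
    · simp only [increasingPolicy]
      split_ifs
      · exact div_nonneg (initWeight_pos hpos _).le (initWeight_pos hpos ε).le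
      · exact le_rfl
  · exact fun ε j hj => if_neg fun h => (h j hj).false
  · intro ε
    have hfilter : (εᶜ.filter fun j => ∀ a ∈ ε, a < j) =
        Finset.univ.filter fun j => ∀ a ∈ ε, a < j := by
      ext j
      simp only [Finset.mem_filter, Finset.mem_compl, Finset.mem_univ, true_and,
        and_iff_right_iff_imp]
      exact fun h hj => (h j hj).false
    simp only [increasingPolicy]
    rw [← Finset.sum_filter, hfilter, ← Finset.sum_div, ← add_div, ← initWeight_eq,
      div_self (initWeight_pos hpos ε).ne']
  · intro ε
    have hperm := Finset.sort_perm_toList ε (· ≤ ·)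
    have hsort : (ε.sort (· ≤ ·)).Pairwise (· < ·) := (Finset.sortedLT_sort ε).pairwise
    rw [← List.sum_toFinset _ (List.nodup_permutations _ ε.nodup_toList),
      Finset.sum_eq_single (ε.sort (· ≤ ·))]
    · have := initWeight_mul_seqProd hpos (ε.sort (· ≤ ·)) ∅ hsort (by simp)
      rwa [initWeight_empty, hsum, one_mul, Finset.empty_union, Finset.sort_toFinset] at this
    · intro L hL hne
      by_contra h
      rw [List.mem_toFinset, List.mem_permutations] at hL
      exact hne ((hL.trans hperm.symm).eq_of_pairwise
        (fun a b _ _ hab hba => (lt_asymm hab hba).elim)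
        (pairwise_lt_of_seqProd_ne_zero L ∅ h).1 hsort)
    · exact fun h => (h (List.mem_toFinset.2 (List.mem_permutations.2 hperm))).elim
end

section
/- The policy transposition map sends sequential policies to probability distributions on subsets: if q is any sequential policy — a function assigning to each ε ⊆ {1,…,m} nonnegative weights on ({1,…,m} \ ε) ∪ {†} with q(j | ε) = 0 for j ∈ ε and q(† | ε) + Σ_{j ∉ ε} q(j | ε) = 1 — then Σ_{ε ⊆ {1,…,m}} φ(q)(ε) = 1, where φ(q)(ε) = Σ over all orderings (j_1,…,j_p) of ε of q(j_1 | ∅) · q(j_2 | {j_1}) · ⋯ · q(j_p | {j_1,…,j_{p−1}}) · q(† | ε). -/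
theorem Finset.mem_permutations_toList {α : Type*} [DecidableEq α] {s : Finset α} {L : List α} :
    L ∈ s.toList.permutations ↔ L.Nodup ∧ L.toFinset = s := by
  rw [List.mem_permutations]
  constructor
  · intro h
    refine ⟨h.nodup_iff.2 s.nodup_toList, ?_⟩
    rw [List.toFinset_eq_of_perm _ _ h, Finset.toList_toFinset]
  · rintro ⟨hL, rfl⟩
    exact (List.toFinset_toList hL).symm

theorem Finset.permutations_toList_toFinset {α : Type*} [DecidableEq α] {s : Finset α}
    (hs : s.Nonempty) :
    s.toList.permutations.toFinset =
      s.biUnion fun j => (s.erase j).toList.permutations.toFinset.image (List.cons j) := by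
  ext L
  simp only [List.mem_toFinset, Finset.mem_permutations_toList, Finset.mem_biUnion,
    Finset.mem_image]
  constructor
  · rintro ⟨hL, rfl⟩
    cases L with
    | nil => simp at hs
    | cons j L =>
      rw [List.nodup_cons] at hL
      exact ⟨j, by simp, L, ⟨hL.2, by simp [hL.1]⟩, rfl⟩
  · rintro ⟨j, hj, L, ⟨hL, hLs⟩, rfl⟩
    have hjL : j ∉ L := by
      rw [← List.mem_toFinset, hLs]
      exact Finset.notMem_erase j s
    exact ⟨List.nodup_cons.2 ⟨hjL, hL⟩, by rw [List.toFinset_cons, hLs, Finset.insert_erase hj]⟩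

theorem Finset.sum_permutations_toList {α M : Type*} [DecidableEq α] [AddCommMonoid M]
    {s : Finset α} (hs : s.Nonempty) (f : List α → M) :
    (s.toList.permutations.map f).sum =
      ∑ j ∈ s, ((s.erase j).toList.permutations.map fun L => f (j :: L)).sum := by
  have key (t : Finset α) (g : List α → M) :
      (t.toList.permutations.map g).sum = ∑ L ∈ t.toList.permutations.toFinset, g L :=
    (List.sum_toFinset g (List.nodup_permutations _ t.nodup_toList)).symm
  simp only [key]
  rw [Finset.permutations_toList_toFinset hs, Finset.sum_biUnion]
  · exact Finset.sum_congr rfl fun j _ => Finset.sum_image (List.cons_injective.injOn)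
  · intro i _ j _ hij
    rw [Function.onFun, Finset.disjoint_left]
    intro L hi hj
    obtain ⟨A, -, rfl⟩ := Finset.mem_image.1 hi
    obtain ⟨B, -, hB⟩ := Finset.mem_image.1 hj
    exact hij (List.cons.inj hB).1.symm

theorem Finset.sum_powerset_sum_erase {α M : Type*} [DecidableEq α] [AddCommMonoid M]
    (u : Finset α) (f : α → Finset α → M) :
    ∑ s ∈ u.powerset, ∑ j ∈ s, f j (s.erase j) =
      ∑ j ∈ u, ∑ t ∈ (u.erase j).powerset, f j t := by
  rw [Finset.sum_sigma', Finset.sum_sigma']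
  refine Finset.sum_bij' (fun x _ => ⟨x.2, x.1.erase x.2⟩) (fun y _ => ⟨insert y.1 y.2, y.1⟩)
    ?_ ?_ ?_ ?_ ?_
  · rintro ⟨s, j⟩ h
    simp only [Finset.mem_sigma, Finset.mem_powerset] at h ⊢
    exact ⟨h.1 h.2, Finset.erase_subset_erase _ h.1⟩
  · rintro ⟨j, t⟩ h
    simp only [Finset.mem_sigma, Finset.mem_powerset] at h ⊢
    exact ⟨Finset.insert_subset h.1 (h.2.trans (Finset.erase_subset _ _)),
      Finset.mem_insert_self _ _⟩
  · rintro ⟨s, j⟩ h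
    simp only [Finset.mem_sigma] at h
    simp [Finset.insert_erase h.2]
  · rintro ⟨j, t⟩ h
    simp only [Finset.mem_sigma, Finset.mem_powerset] at h
    have hj : j ∉ t := fun hj => Finset.notMem_erase j u (h.2 hj)
    simp [Finset.erase_insert hj]
  · intro x _
    rfl

/-- Conditioned on having already chosen `ε`, the masses of the sets that may still be added
sum to one. -/
theorem sum_powerset_compl_seqProd {m : ℕ} (q : Finset (Fin m) → Option (Fin m) → ℝ)
    (hnorm : ∀ ε : Finset (Fin m), q ε none + ∑ j ∈ εᶜ, q ε (some j) = 1)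
    (ε : Finset (Fin m)) :
    ∑ s ∈ εᶜ.powerset, (s.toList.permutations.map fun L => seqProd q ε L).sum = 1 := by
  induction h : εᶜ.card generalizing ε with
  | zero =>
    have h0 := Finset.card_eq_zero.1 h
    have := hnorm ε
    rw [h0, Finset.sum_empty, add_zero] at this
    simp [h0, seqProd, this]
  | succ n ih =>
    have step (s : Finset (Fin m)) :
        (s.toList.permutations.map fun L => seqProd q ε L).sum =
          (if s = ∅ then q ε none else 0) + ∑ j ∈ s, q ε (some j) *
            ((s.erase j).toList.permutations.map fun L => seqProd q (insert j ε) L).sum := by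
      rcases s.eq_empty_or_nonempty with rfl | hs
      · simp [seqProd]
      · rw [Finset.sum_permutations_toList hs, if_neg hs.ne_empty, zero_add]
        exact Finset.sum_congr rfl fun j _ => by simp only [seqProd, List.sum_map_mul_left]
    simp only [step]
    rw [Finset.sum_add_distrib, Finset.sum_ite_eq', if_pos (Finset.empty_mem_powerset _),
      Finset.sum_powerset_sum_erase εᶜ fun j t => q ε (some j) *
        (t.toList.permutations.map fun L => seqProd q (insert j ε) L).sum,
      ← hnorm ε]
    congr 1
    refine Finset.sum_congr rfl fun j hj => ?_
    rw [← Finset.mul_sum, ← Finset.compl_insert, ih (insert j ε), mul_one]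
    rw [Finset.compl_insert, Finset.card_erase_of_mem hj, h, Nat.add_sub_cancel]

/-- The policy transposition map `φ` sends sequential policies to probability
distributions on subsets: if `q` is a sequential policy — nonnegative weights on
`(Fin m \ ε) ∪ {†}` with `q(j | ε) = 0` for `j ∈ ε` and
`q(† | ε) + Σ_{j ∉ ε} q(j | ε) = 1` — then `Σ_{ε ⊆ Fin m} φ(q)(ε) = 1`, where
`φ(q)(ε)` is the sum over all orderings `(j₁, …, jₚ)` of `ε` of
`q(j₁ | ∅) · q(j₂ | {j₁}) · ⋯ · q(jₚ | {j₁,…,j_{p−1}}) · q(† | ε)`. -/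
theorem policy_transposition_is_distribution (m : ℕ) (hm : 1 ≤ m)
    (q : Finset (Fin m) → Option (Fin m) → ℝ)
    (hnonneg : ∀ ε : Finset (Fin m), ∀ x : Option (Fin m), 0 ≤ q ε x)
    (hzero : ∀ ε : Finset (Fin m), ∀ j ∈ ε, q ε (some j) = 0)
    (hnorm : ∀ ε : Finset (Fin m), q ε none + ∑ j ∈ εᶜ, q ε (some j) = 1) :
    ∑ ε : Finset (Fin m),
      ((ε.toList.permutations).map (fun L => seqProd q ∅ L)).sum = 1 := by
  simpa using sum_powerset_compl_seqProd q hnorm ∅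
end
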